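/- There exists a nonerasing stack automaton A such that the language L(A) is not an MCFL (no m-MCFG generates L(A) for any m); that is, the class of MCFLs does not contain the class NESL of nonerasing stack languages. -/

import Mathlib

namespace Rewbs

/-- Extended alphabet Δ = Σ ⊎ B ⊎ ℕ⁺ : ordinary characters, brackets `[_i`, `]_i`,
and number characters (references). -/
inductive RSym (A : Type) : Type where
  | ch : A → RSym A
  | open_ : ℕ+ → RSym A
  | close : ℕ+ → RSym A
  | ref : ℕ+ → RSym A

/-- The alphabet Σ ⊎ B (no number characters). -/
inductive BSym (A : Type) : Type where
  | ch : A → BSym A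
  | open_ : ℕ+ → BSym A
  | close : ℕ+ → BSym A

/-- The homomorphism g : (Σ ⊎ B)* → Σ* erasing brackets. -/
def projB {A : Type} (v : List (BSym A)) : List A :=
  v.filterMap fun c => match c with
    | .ch a => some a
    | _ => none

/-- The fetching function fet_i. -/
noncomputable def fet {A : Type} (i : ℕ+) (v : List (BSym A)) : List A :=
  letI : DecidableEq (BSym A) := Classical.decEq _
  if BSym.open_ i ∈ v then
    projB (((v.reverse.takeWhile (fun c => decide (c ≠ BSym.open_ i))).reverse).takeWhile
      (fun c => decide (c ≠ BSym.close i)))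
  else []

/-- One step of the pre-dereferencing function (processing one character, appended
at the right of the already-processed string). -/
noncomputable def derefStep {A : Type} (acc : List (BSym A)) : RSym A → List (BSym A)
  | .ch a => acc ++ [BSym.ch a]
  | .open_ i => acc ++ [BSym.open_ i]
  | .close i => acc ++ [BSym.close i]
  | .ref i => acc ++ (fet i acc).map BSym.ch

/-- The pre-dereferencing function D : Δ* → (Σ ⊎ B)*. -/
noncomputable def preDeref {A : Type} (v : List (RSym A)) : List (BSym A) :=
  v.foldl derefStep []

/-- μ_i = fet_i ∘ D. -/
noncomputable def mu {A : Type} (i : ℕ+) (v : List (RSym A)) : List A :=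
  fet i (preDeref v)

/-- deref = g ∘ D. -/
noncomputable def deref {A : Type} (v : List (RSym A)) : List A :=
  projB (preDeref v)

/-- One step of the `open` function. -/
def openStep {A : Type} (s : Finset ℕ+) : RSym A → Finset ℕ+
  | .open_ i => insert i s
  | .close i => s.erase i
  | _ => s

/-- open : Δ* → finite subsets of ℕ⁺. -/
def openSet {A : Type} (v : List (RSym A)) : Finset ℕ+ :=
  v.foldl openStep ∅

/-- Syntax of regular expressions with backreferences (rewb). -/
inductive Rewb (A : Type) : Type where
  | ch : A → Rewb A
  | eps : Rewb A
  | backref : ℕ+ → Rewb A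
  | cat : Rewb A → Rewb A → Rewb A
  | alt : Rewb A → Rewb A → Rewb A
  | star : Rewb A → Rewb A
  | grp : ℕ+ → Rewb A → Rewb A

/-- `hasIdx i α` : the capturing group `(_i )_i` or the reference `\i` occurs in α. -/
def hasIdx {A : Type} (i : ℕ+) : Rewb A → Prop
  | .ch _ => False
  | .eps => False
  | .backref j => j = i
  | .cat r s => hasIdx i r ∨ hasIdx i s
  | .alt r s => hasIdx i r ∨ hasIdx i s
  | .star r => hasIdx i r
  | .grp j r => j = i ∨ hasIdx i r

/-- Well-formedness of a rewb: in `(_i α)_i`, the body α contains neither the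
capturing group `(_i )_i` nor the reference `\i`. -/
def Rewb.WF {A : Type} : Rewb A → Prop
  | .ch _ => True
  | .eps => True
  | .backref _ => True
  | .cat r s => r.WF ∧ s.WF
  | .alt r s => r.WF ∧ s.WF
  | .star r => r.WF
  | .grp i r => r.WF ∧ ¬ hasIdx i r

/-- The ref-language Ref(α) ⊆ Δ*. -/
def Ref {A : Type} : Rewb A → Language (RSym A)
  | .ch a => {[RSym.ch a]}
  | .eps => 1
  | .backref i => {[RSym.ref i]}
  | .cat r s => Ref r * Ref s
  | .alt r s => Ref r + Ref s
  | .star r => KStar.kstar (Ref r)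
  | .grp i r => ({[RSym.open_ i]} : Language (RSym A)) * Ref r * ({[RSym.close i]} : Language (RSym A))

/-- The language of a rewb: L(α) = deref(Ref(α)). -/
noncomputable def rewbLang {A : Type} (r : Rewb A) : Set (List A) :=
  deref '' (Ref r : Set (List (RSym A)))

/-- capt(α): the set of indices guaranteed to be captured. -/
def capt {A : Type} : Rewb A → Set ℕ+
  | .ch _ => ∅
  | .eps => ∅
  | .backref _ => ∅
  | .cat r s => capt r ∪ capt s
  | .alt r s => capt r ∩ capt s
  | .star r => capt r
  | .grp i r => capt r ∪ {i}

/-- The relation S ⊢ α. -/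
def Sat {A : Type} : Rewb A → Set ℕ+ → Prop
  | .ch _, _ => True
  | .eps, _ => True
  | .backref i, S => i ∈ S
  | .cat r s, S => Sat r S ∧ Sat s (S ∪ capt r)
  | .alt r s, S => Sat r S ∧ Sat s S
  | .star r, S => Sat r S
  | .grp _ r, S => Sat r S

/-- A rewb is closed if ∅ ⊢ α. -/
def Rewb.Closed {A : Type} (r : Rewb A) : Prop := Sat r ∅

/-- A rewb is closed-star if the body of every starred subexpression is closed. -/
def Rewb.ClosedStar {A : Type} : Rewb A → Prop
  | .ch _ => True
  | .eps => True
  | .backref _ => True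
  | .cat r s => r.ClosedStar ∧ s.ClosedStar
  | .alt r s => r.ClosedStar ∧ s.ClosedStar
  | .star r => r.ClosedStar ∧ r.Closed
  | .grp _ r => r.ClosedStar

/-- All indices (number characters and capturing-group indices) occurring in α are ≤ κ. -/
def Rewb.IdxLe {A : Type} (κ : ℕ) : Rewb A → Prop
  | .ch _ => True
  | .eps => True
  | .backref i => (i : ℕ) ≤ κ
  | .cat r s => r.IdxLe κ ∧ s.IdxLe κ
  | .alt r s => r.IdxLe κ ∧ s.IdxLe κ
  | .star r => r.IdxLe κ
  | .grp i r => (i : ℕ) ≤ κ ∧ r.IdxLe κ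

/-- All indices occurring in a character of Δ are ≤ κ. -/
def RSym.idxLe {A : Type} (κ : ℕ) : RSym A → Prop
  | .ch _ => True
  | .open_ i => (i : ℕ) ≤ κ
  | .close i => (i : ℕ) ≤ κ
  | .ref i => (i : ℕ) ≤ κ

/-! ### The tuple functions φ used in the unary-PMCFG construction -/

/-- The ℕ⁺ index corresponding to `j : Fin κ` (memory cell j+1). -/
def toP {κ : ℕ} (j : Fin κ) : ℕ+ := ⟨j.1 + 1, Nat.succ_pos _⟩

/-- φ_c^M : the input/paste/reset/identity functions on (κ+1)-tuples of strings. -/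
def phi {A : Type} (κ : ℕ) (M : Finset ℕ+) :
    RSym A → (List A × (Fin κ → List A)) → (List A × (Fin κ → List A))
  | RSym.ch a, (x, y) => (x ++ [a], fun j => if toP j ∈ M then y j ++ [a] else y j)
  | RSym.ref k, (x, y) =>
      let yk : List A := if h : k.1 ≤ κ ∧ 1 ≤ k.1 then y ⟨k.1 - 1, by omega⟩ else []
      (x ++ yk, fun j => if toP j ∈ M then y j ++ yk else y j)
  | RSym.open_ k, (x, y) => (x, fun j => if toP j = k then [] else y j)
  | RSym.close _, t => t

/-- Apply the functions φ_{v_r}^{open(prefix·v₁⋯v_r)} successively, left to right,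
where `pref` is the already-processed prefix. -/
noncomputable def derefRun {A : Type} (κ : ℕ) :
    List (RSym A) → List (RSym A) → (List A × (Fin κ → List A)) → (List A × (Fin κ → List A))
  | _, [], t => t
  | pref, c :: rest, t => derefRun κ (pref ++ [c]) rest (phi κ (openSet (pref ++ [c])) c t)

/-! ### The quantities t and s -/

/-- One (right-to-left) step of the t-sequence. -/
def tStep {A : Type} (c : RSym A) (t : ℕ+ → ℕ) : ℕ+ → ℕ :=
  match c with
  | .ch _ => t
  | .close _ => t
  | .open_ j => fun k => if k = j then 0 else t k
  | .ref j => fun k => if k = j then t k + 1 else t k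

/-- `tOf suf k` is t_{i,k} where `suf` is the suffix v_{i+1} ⋯ v_m of v. -/
def tOf {A : Type} : List (RSym A) → ℕ+ → ℕ
  | [] => fun _ => 0
  | c :: rest => tStep c (tOf rest)

/-- One (right-to-left) step of the s-sequence; `O` is open(v₁⋯v_i). -/
def sStep {A : Type} (O : Finset ℕ+) (c : RSym A) (s : ℕ+ → ℕ) : ℕ+ → ℕ :=
  match c with
  | .ch _ => s
  | .close _ => s
  | .open_ j => fun k => if k = j then 0 else s k
  | .ref j => fun k => if k = j then max (max 1 (s j)) (O.sup fun l => s l + 1) else s k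

/-- `sOf pref suf k` is s_{i,k} where v = pref ++ suf and i = |pref|. -/
def sOf {A : Type} : List (RSym A) → List (RSym A) → ℕ+ → ℕ
  | _, [] => fun _ => 0
  | pref, c :: rest => sStep (openSet (pref ++ [c])) c (sOf (pref ++ [c]) rest)

/-! ### Parallel multiple context-free grammars -/

/-- An item of an output component of a PMCFG function: a constant string
or the j-th component of the i-th argument. -/
inductive PItem (T : Type) : Type where
  | const : List T → PItem T
  | arg : ℕ → ℕ → PItem T

/-- A rule A → f[A₁,…,A_l] of a PMCFG, where f is given syntactically by the
lists of items of its output components. -/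
structure PRule (T N : Type) : Type where
  lhs : N
  rhs : List N
  out : List (List (PItem T))

/-- A PMCFG with nonterminals `Fin n`. -/
structure PMCFG (T : Type) : Type where
  n : ℕ
  dim : Fin n → ℕ
  start : Fin n
  rules : List (PRule T (Fin n))

/-- Evaluation of a single item, given the tuples derived from the arguments. -/
def evalItem {T : Type} (args : List (List (List T))) : PItem T → List T
  | .const c => c
  | .arg i j => (args.getD i []).getD j []

/-- Evaluation of one output component. -/
def evalItems {T : Type} (args : List (List (List T))) (items : List (PItem T)) : List T :=
  (items.map (evalItem args)).flatten

/-- The set L_G(A) of tuples derived from each nonterminal. -/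
inductive PMCFG.Derives {T : Type} (G : PMCFG T) : Fin G.n → List (List T) → Prop
  | step (r : PRule T (Fin G.n)) (hr : r ∈ G.rules) (args : List (List (List T)))
      (hargs : List.Forall₂ G.Derives r.rhs args) :
      G.Derives r.lhs (r.out.map (evalItems args))

/-- L(G) = L_G(S), identifying 1-tuples with strings. -/
def PMCFG.lang {T : Type} (G : PMCFG T) : Set (List T) :=
  {w | G.Derives G.start [w]}

/-- Well-formedness of a rule with respect to the dimension assignment. -/
def PRule.WFdim {T N : Type} (dim : N → ℕ) (r : PRule T N) : Prop :=
  r.out.length = dim r.lhs ∧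
  ∀ items ∈ r.out, ∀ it ∈ items, ∀ i j, it = PItem.arg i j →
    ∃ h : i < r.rhs.length, j < dim (r.rhs.get ⟨i, h⟩)

/-- G is a well-formed m-PMCFG. -/
def PMCFG.WF {T : Type} (G : PMCFG T) (m : ℕ) : Prop :=
  (∀ A : Fin G.n, 1 ≤ G.dim A ∧ G.dim A ≤ m) ∧ G.dim G.start = 1 ∧
  ∀ r ∈ G.rules, r.WFdim G.dim

/-- G is unary: every function takes at most one argument. -/
def PMCFG.Unary {T : Type} (G : PMCFG T) : Prop :=
  ∀ r ∈ G.rules, r.rhs.length ≤ 1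

/-- The list of argument components referenced by a rule. -/
def PRule.argRefs {T N : Type} (r : PRule T N) : List (ℕ × ℕ) :=
  r.out.flatten.filterMap fun it => match it with
    | .arg i j => some (i, j)
    | _ => none

/-- G is an MCFG: no rule uses the same argument component more than once. -/
def PMCFG.NonDup {T : Type} (G : PMCFG T) : Prop :=
  ∀ r ∈ G.rules, r.argRefs.Nodup

/-! ### Stack automata -/

/-- Direction of the stack pointer. -/
inductive SDir : Type where
  | left | stay | right
deriving DecidableEq

/-- A one-way nondeterministic stack automaton.  The input symbol `none`
denotes the endmarker ▷.  `push q a Z` is the pushdown mode (applicable when the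
stack pointer is at the top symbol Z; the Bool is whether the input head moves
right); `read q a Z top` is the stack-reading mode (`top` tells whether the
pointed symbol Z is the topmost one). -/
structure SA (T : Type) : Type 1 where
  Q : Type
  finQ : Fintype Q
  Γ : Type
  finΓ : Fintype Γ
  q0 : Q
  Z0 : Γ
  F : Set Q
  push : Q → Option T → Γ → Set (Q × Bool × List Γ)
  read : Q → Option T → Γ → Bool → Set (Q × Bool × SDir)

namespace SA

/-- Instantaneous description: state, remaining input (the endmarker ▷ is
implicit at the end), stack below-and-including the pointer, stack above the
pointer. -/
def Conf {T : Type} (M : SA T) : Type := M.Q × List T × List M.Γ × List M.Γ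

/-- Move the stack pointer: the stack is γ ++ [Z] ++ above with the pointer on Z. -/
def moveStack {Γ : Type} : SDir → List Γ → Γ → List Γ → List Γ × List Γ
  | .left, γ, Z, above => (γ, Z :: above)
  | .stay, γ, Z, above => (γ ++ [Z], above)
  | .right, γ, Z, b :: rest => (γ ++ [Z, b], rest)
  | .right, γ, Z, [] => (γ ++ [Z], [])

/-- One move of a stack automaton on instantaneous descriptions. -/
inductive Step {T : Type} (M : SA T) : M.Conf → M.Conf → Prop
  | push (q : M.Q) (u : List T) (γ : List M.Γ) (Z : M.Γ) (q' : M.Q) (d : Bool) (y : List M.Γ)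
      (hmem : (q', d, y) ∈ M.push q u.head? Z)
      (hd : d = true → u ≠ []) :
      Step M (q, u, γ ++ [Z], []) (q', if d then u.tail else u, γ ++ y, [])
  | read (q : M.Q) (u : List T) (γ : List M.Γ) (Z : M.Γ) (above : List M.Γ)
      (q' : M.Q) (d : Bool) (e : SDir)
      (hmem : (q', d, e) ∈ M.read q u.head? Z above.isEmpty)
      (hd : d = true → u ≠ [])
      (hleft : e = SDir.left → γ ≠ [])
      (hright : e = SDir.right → above ≠ []) :
      Step M (q, u, γ ++ [Z], above)
        (q', if d then u.tail else u, (moveStack e γ Z above).1, (moveStack e γ Z above).2)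

/-- Acceptance: from (q₀, w▷, Z₀↑$) reach a final state with the whole input read. -/
def Accepts {T : Type} (M : SA T) (w : List T) : Prop :=
  ∃ (qf : M.Q) (g1 g2 : List M.Γ), qf ∈ M.F ∧
    Relation.ReflTransGen (Step M) (M.q0, w, [M.Z0], []) (qf, [], g1, g2)

/-- The language of a stack automaton. -/
def lang {T : Type} (M : SA T) : Set (List T) := {w | M.Accepts w}

/-- Nonerasing: every pushdown-mode transition pushes a nonempty word. -/
def NonErasing {T : Type} (M : SA T) : Prop :=
  ∀ q a Z q' d y, (q', d, y) ∈ M.push q a Z → y ≠ []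

end SA

/-! ### Additive weight grammars -/

/-- A tree grammar with additive weights: the rule `r` rewrites `lhs r` into the list of states
`child r` and contributes the weight `wt r`. -/
structure WGrammar (σ ι : Type) : Type where
  lhs : ι → σ
  wt : ι → ℕ
  ar : ι → ℕ
  child : (r : ι) → Fin (ar r) → σ

namespace WGrammar

variable {σ ι : Type}

/-- `W.Yields X s x`: some derivation tree with root `s` and total weight `x` avoids the states
in `X`. -/
inductive Yields (W : WGrammar σ ι) (X : Finset σ) : σ → ℕ → Prop
  | step (r : ι) (hr : W.lhs r ∉ X) (x : Fin (W.ar r) → ℕ)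
      (hx : ∀ i, Yields W X (W.child r i) (x i)) :
      Yields W X (W.lhs r) (W.wt r + ∑ i, x i)

/-- `W.Ctx s t b`: a tree with root `t` can be extended to one with root `s`, at additional
weight `b`. -/
def Ctx (W : WGrammar σ ι) (s t : σ) (b : ℕ) : Prop :=
  ∀ x, W.Yields ∅ t x → W.Yields ∅ s (x + b)

variable {W : WGrammar σ ι}

theorem Yields.of_avoiding {X : Finset σ} {s : σ} {x : ℕ} (h : W.Yields X s x) :
    W.Yields ∅ s x := by
  induction h with
  | step r hr x hx ih => exact .step r (by simp) x ih

theorem Yields.notMem {X : Finset σ} {s : σ} {x : ℕ} (h : W.Yields X s x) : s ∉ X := by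
  cases h; assumption

theorem Ctx.refl (s : σ) : W.Ctx s s 0 := fun _ h => h

theorem Ctx.trans {s t u : σ} {b c : ℕ} (h₁ : W.Ctx s t b) (h₂ : W.Ctx t u c) :
    W.Ctx s u (c + b) := fun x hx => by
  rw [← add_assoc]
  exact h₁ _ (h₂ _ hx)

theorem Ctx.iterate {s : σ} {b : ℕ} (h : W.Ctx s s b) (k : ℕ) : W.Ctx s s (k * b) := by
  induction k with
  | zero => simpa using Ctx.refl s
  | succ k ih => simpa [add_mul, add_comm] using h.trans ih

theorem Ctx.child (r : ι) (x : Fin (W.ar r) → ℕ) (hx : ∀ i, W.Yields ∅ (W.child r i) (x i))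
    (i : Fin (W.ar r)) :
    W.Ctx (W.lhs r) (W.child r i) (W.wt r + ∑ j ∈ Finset.univ \ {i}, x j) := by
  intro y hy
  have key := Yields.step (W := W) (X := ∅) r (by simp) (Function.update x i y) (fun j => by
    by_cases h : j = i
    · subst h; simpa using hy
    · simpa [Function.update_of_ne h] using hx j)
  rw [Finset.sum_update_of_mem (Finset.mem_univ i)] at key
  convert key using 1
  ring

theorem Yields.insert_or_ctx [DecidableEq σ] {X : Finset σ} {t : σ} {y : ℕ}
    (h : W.Yields X t y) (s : σ) :
    W.Yields (insert s X) t y ∨ ∃ b r, ∃ x : Fin (W.ar r) → ℕ, W.lhs r = s ∧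
      y = W.wt r + ∑ i, x i + b ∧ W.Ctx t s b ∧
      ∀ i, W.Yields (insert s X) (W.child r i) (x i) := by
  induction h with
  | step r hr x hx ih =>
    by_cases hall : ∀ i, W.Yields (insert s X) (W.child r i) (x i)
    · by_cases hs : W.lhs r = s
      · exact .inr ⟨0, r, x, hs, rfl, hs ▸ Ctx.refl _, hall⟩
      · exact .inl (.step r (by simp [hs, hr]) x hall)
    · push Not at hall
      obtain ⟨i, hi⟩ := hall
      obtain ⟨b, r', x', hr', hxi, hctx, hx'⟩ := (ih i).resolve_left hi
      refine .inr ⟨b + (W.wt r + ∑ j ∈ Finset.univ \ {i}, x j), r', x', hr', ?_,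
        (Ctx.child r x (fun j => (hx j).of_avoiding) i).trans hctx, hx'⟩
      rw [← add_assoc (_ + _) b, ← hxi, ← Finset.add_sum_erase _ _ (Finset.mem_univ i),
        Finset.sdiff_singleton_eq_erase]
      ring

theorem exists_bound_of_ctx_eq_zero [Finite σ] [Finite ι] (s₀ : σ)
    (hzero : ∀ s c b x, W.Ctx s₀ s c → W.Ctx s s b → W.Yields ∅ s x → b = 0) (X : Finset σ) :
    ∃ B, ∀ s c x, W.Ctx s₀ s c → W.Yields X s x → x ≤ B := by
  classical
  have := Fintype.ofFinite σ
  have := Fintype.ofFinite ι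
  induction X using WellFoundedGT.induction with
  | ind X ih =>
  have ih' : ∀ s, ∃ B, s ∉ X → ∀ t c x, W.Ctx s₀ t c → W.Yields (insert s X) t x → x ≤ B := by
    intro s
    by_cases hs : s ∈ X
    · exact ⟨0, fun h => absurd hs h⟩
    · obtain ⟨B, hB⟩ := ih (insert s X) (Finset.ssubset_insert hs)
      exact ⟨B, fun _ => hB⟩
  choose B hB using ih'
  refine ⟨∑ r, (W.wt r + W.ar r * B (W.lhs r)), fun s c x hc hx => ?_⟩
  rcases hx.insert_or_ctx s with h | ⟨b, r, y, rfl, rfl, hb, hy⟩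
  · exact absurd (Finset.mem_insert_self s X) h.notMem
  · have hb0 := hzero _ _ _ _ hc hb hx.of_avoiding
    have hle : ∀ i, y i ≤ B (W.lhs r) := fun i =>
      hB _ hx.notMem _ _ _ (hc.trans (Ctx.child r y (fun j => (hy j).of_avoiding) i)) (hy i)
    have hsum : ∑ i, y i ≤ W.ar r * B (W.lhs r) := by
      simpa using Finset.sum_le_card_nsmul Finset.univ y _ fun i _ => hle i
    calc W.wt r + ∑ i, y i + b ≤ W.wt r + W.ar r * B (W.lhs r) := by omega
      _ ≤ _ := Finset.single_le_sum (f := fun r => W.wt r + W.ar r * B (W.lhs r))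
        (fun _ _ => Nat.zero_le _) (Finset.mem_univ r)

/-- An unbounded set of derivable weights contains an infinite arithmetic progression. -/
theorem exists_progression [Finite σ] [Finite ι] (s₀ : σ)
    (hunb : ∀ B, ∃ x, B < x ∧ W.Yields ∅ s₀ x) :
    ∃ a b, 0 < b ∧ ∀ k, W.Yields ∅ s₀ (a + k * b) := by
  by_contra! hno
  obtain ⟨B, hB⟩ := exists_bound_of_ctx_eq_zero (W := W) s₀ (fun s c b x hc hb hx => by
    by_contra hb0
    obtain ⟨k, hk⟩ := hno (x + c) b (Nat.pos_of_ne_zero hb0)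
    apply hk
    have := hc _ (hb.iterate k _ hx)
    convert this using 1
    ring) ∅
  obtain ⟨x, hlt, hx⟩ := hunb B
  exact absurd (hB s₀ 0 x (Ctx.refl _) hx) (by omega)

end WGrammar

/-! ### The weight grammar of an MCFG -/

namespace PMCFG

variable {T : Type}

/-- The argument components referenced in one output component. -/
def itemRefs (items : List (PItem T)) : List (ℕ × ℕ) :=
  items.filterMap fun it => match it with
    | .arg i j => some (i, j)
    | _ => none

/-- The total length of the constants in one output component. -/
def constLength : List (PItem T) → ℕ
  | [] => 0
  | .const c :: l => c.length + constLength l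
  | .arg _ _ :: l => constLength l

theorem length_evalItems (args : List (List (List T))) (items : List (PItem T)) :
    (evalItems args items).length = constLength items +
      ((itemRefs items).map fun p => ((args.getD p.1 []).getD p.2 []).length).sum := by
  induction items with
  | nil => rfl
  | cons it l ih =>
    have hcons : evalItems args (it :: l) = evalItem args it ++ evalItems args l := rfl
    rw [hcons, List.length_append, ih]
    cases it with
    | const c => simp [evalItem, constLength, itemRefs, add_assoc]
    | arg i j => simp [evalItem, constLength, itemRefs, add_left_comm]

/-- The total length of the components of `ξ` with index in `U`. -/
def compLength {m : ℕ} (U : Finset (Fin m)) (ξ : List (List T)) : ℕ :=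
  ∑ k ∈ U, (ξ.getD k []).length

/-- The number of references to component `j` of argument `i` in the output components with
index in `U`. -/
def refCount {m : ℕ} (out : List (List (PItem T))) (U : Finset (Fin m)) (i j : ℕ) : ℕ :=
  ∑ k ∈ U, (itemRefs (out.getD k [])).count (i, j)

/-- The components of argument `i` referenced in the output components with index in `U`. -/
def usedComps {m : ℕ} (out : List (List (PItem T))) (U : Finset (Fin m)) (i : ℕ) :
    Finset (Fin m) :=
  Finset.univ.filter fun j => refCount out U i j ≠ 0

theorem sum_getD_le {m : ℕ} {α : Type} (L : List (List α)) (g : List α → ℕ) (hg : g [] = 0)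
    (U : Finset (Fin m)) : ∑ k ∈ U, g (L.getD k []) ≤ (L.map g).sum := by
  calc ∑ k ∈ U, g (L.getD k []) ≤ ∑ k : Fin m, g (L.getD k []) :=
        Finset.sum_le_sum_of_subset (Finset.subset_univ U)
    _ = ∑ k ∈ Finset.range m, g (L.getD k []) :=
        Fin.sum_univ_eq_sum_range (fun k => g (L.getD k [])) m
    _ ≤ (L.map g).sum := by
      clear U
      induction L generalizing m with
      | nil => simp [hg]
      | cons a L ih =>
        cases m with
        | zero => simp
        | succ m =>
          rw [Finset.sum_range_succ']
          have := ih (m := m)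
          simp only [List.getD_cons_succ, List.getD_cons_zero, List.map_cons, List.sum_cons]
          omega

theorem argRefs_eq {N : Type} (r : PRule T N) : r.argRefs = (r.out.map itemRefs).flatten := by
  unfold PRule.argRefs
  rw [List.filterMap_flatten]
  rfl

theorem refCount_le_one {N : Type} {m : ℕ} (r : PRule T N) (hr : r.argRefs.Nodup)
    (U : Finset (Fin m)) (i j : ℕ) : refCount r.out U i j ≤ 1 := by
  calc refCount r.out U i j ≤ (r.out.map fun l => (itemRefs l).count (i, j)).sum :=
        sum_getD_le r.out (fun l => (itemRefs l).count (i, j)) rfl U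
    _ = r.argRefs.count (i, j) := by
        rw [argRefs_eq, List.count_flatten, List.map_map]; rfl
    _ ≤ 1 := List.nodup_iff_count_le_one.mp hr _

theorem mem_itemRefs {items : List (PItem T)} {p : ℕ × ℕ} (h : p ∈ itemRefs items) :
    PItem.arg p.1 p.2 ∈ items := by
  unfold itemRefs at h
  rw [List.mem_filterMap] at h
  obtain ⟨it, hit, h⟩ := h
  cases it with
  | const c => simp at h
  | arg i j =>
    simp only [Option.some.injEq] at h
    subst h
    exact hit

theorem sum_map_eq_sum_count {l m : ℕ} (L : List (ℕ × ℕ)) (hL : ∀ p ∈ L, p.1 < l ∧ p.2 < m)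
    (f : ℕ → ℕ → ℕ) :
    (L.map fun p => f p.1 p.2).sum = ∑ i : Fin l, ∑ j : Fin m, L.count (i.1, j.1) * f i j := by
  have hsum : (L.map fun p => f p.1 p.2).sum = ∑ p ∈ L.toFinset, L.count p * f p.1 p.2 := by
    rw [Finset.sum_list_map_count]
    exact Finset.sum_congr rfl fun p _ => by rw [smul_eq_mul]; congr!
  rw [hsum]
  have : L.toFinset ⊆ Finset.range l ×ˢ Finset.range m := by
    intro p hp
    simpa using hL p (by simpa using hp)
  rw [Finset.sum_subset this (fun p _ hp => by
    rw [List.count_eq_zero_of_not_mem (by simpa using hp), zero_mul]), Finset.sum_product]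
  dsimp only
  rw [← Fin.sum_univ_eq_sum_range (fun i => ∑ j ∈ Finset.range m, L.count (i, j) * f i j) l]
  refine Finset.sum_congr rfl fun i _ => ?_
  rw [← Fin.sum_univ_eq_sum_range (fun j => L.count (i.1, j) * f i j) m]

theorem compLength_map_evalItems {N : Type} {m : ℕ} {dim : N → ℕ} (hdim : ∀ A, dim A ≤ m)
    (r : PRule T N) (hwf : r.WFdim dim) (hr : r.argRefs.Nodup) (U : Finset (Fin m))
    (args : List (List (List T))) :
    compLength U (r.out.map (evalItems args)) = (∑ k ∈ U, constLength (r.out.getD k [])) +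
      ∑ i : Fin r.rhs.length, compLength (usedComps r.out U i) (args.getD i []) := by
  have hgetD : ∀ k, (r.out.map (evalItems args)).getD k [] = evalItems args (r.out.getD k []) :=
    fun k => List.getD_map (d := []) (f := evalItems args) ..
  have hrange : ∀ k, ∀ p ∈ itemRefs (r.out.getD k []), p.1 < r.rhs.length ∧ p.2 < m := by
    intro k p hp
    have hmem := mem_itemRefs hp
    by_cases hk : k < r.out.length
    · rw [List.getD_eq_getElem _ _ hk] at hmem
      obtain ⟨h, hj⟩ := hwf.2 _ (List.getElem_mem hk) _ hmem _ _ rfl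
      exact ⟨h, hj.trans_le (hdim _)⟩
    · rw [List.getD_eq_default _ _ (by omega)] at hmem
      simp at hmem
  unfold compLength
  simp only [hgetD, length_evalItems, Finset.sum_add_distrib]
  congr 1
  refine (Finset.sum_congr rfl fun (k : Fin m) _ => sum_map_eq_sum_count _ (hrange k)
    (fun i j => ((args.getD i []).getD j []).length)).trans ?_
  rw [Finset.sum_comm]
  refine Finset.sum_congr rfl fun i _ => ?_
  rw [Finset.sum_comm, usedComps, Finset.sum_filter]
  refine Finset.sum_congr rfl fun j _ => ?_
  rw [← Finset.sum_mul]
  change refCount r.out U i j * _ = _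
  have := refCount_le_one r hr U i j
  split_ifs with h
  · rw [show refCount r.out U i j = 1 by omega, one_mul]
  · rw [show refCount r.out U i j = 0 by omega, zero_mul]

/-- The weight grammar whose states are a nonterminal with a set of components, and whose weights
are the total lengths of these components. -/
def wGrammar (G : PMCFG T) (m : ℕ) :
    WGrammar (Fin G.n × Finset (Fin m)) (Fin G.rules.length × Finset (Fin m)) where
  lhs r := (G.rules[r.1].lhs, r.2)
  wt r := ∑ k ∈ r.2, constLength (G.rules[r.1].out.getD k [])
  ar r := G.rules[r.1].rhs.length
  child r i := (G.rules[r.1].rhs[i], usedComps G.rules[r.1].out r.2 i)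

theorem Derives.induction {G : PMCFG T} {P : Fin G.n → List (List T) → Prop}
    (h : ∀ r ∈ G.rules, ∀ args, List.Forall₂ P r.rhs args →
      P r.lhs (r.out.map (evalItems args))) {A : Fin G.n} {ξ : List (List T)}
    (hd : G.Derives A ξ) : P A ξ :=
  Derives.rec (motive_1 := fun A ξ _ => P A ξ) (motive_2 := fun l l' _ => List.Forall₂ P l l')
    (fun r hr args _ ih => h r hr args ih) .nil (fun _ _ h₁ h₂ => .cons h₁ h₂) hd

theorem Derives.length_eq {G : PMCFG T} {m : ℕ} (hG : G.WF m) {A : Fin G.n}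
    {ξ : List (List T)} (hd : G.Derives A ξ) : ξ.length = G.dim A := by
  cases hd with
  | step r hr args hargs => simpa using (hG.2.2 r hr).1

theorem Derives.yields {G : PMCFG T} {m : ℕ} (hG : G.WF m) (hdup : G.NonDup) {A : Fin G.n}
    {ξ : List (List T)} (hd : G.Derives A ξ) :
    ∀ U, (G.wGrammar m).Yields ∅ (A, U) (compLength U ξ) := by
  refine hd.induction (P := fun A ξ => ∀ U, (G.wGrammar m).Yields ∅ (A, U) (compLength U ξ)) ?_
  intro r hr args hargs U
  rw [compLength_map_evalItems (fun A => (hG.1 A).2) r (hG.2.2 r hr) (hdup r hr)]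
  obtain ⟨n, hn, rfl⟩ := List.getElem_of_mem hr
  refine WGrammar.Yields.step (W := G.wGrammar m) (⟨n, hn⟩, U) (by simp) _ fun i => ?_
  have hi : i.1 < args.length := hargs.length_eq ▸ i.2
  rw [List.getD_eq_getElem _ _ hi]
  exact hargs.get i.2 hi _

theorem exists_derives_of_yields {G : PMCFG T} {m : ℕ} (hG : G.WF m) (hdup : G.NonDup)
    {s : Fin G.n × Finset (Fin m)} {x : ℕ} (h : (G.wGrammar m).Yields ∅ s x) :
    ∃ ξ, G.Derives s.1 ξ ∧ compLength s.2 ξ = x := by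
  induction h with
  | step r hr x hx ih =>
    choose ξ hξ hlen using ih
    have hmem : G.rules[r.1] ∈ G.rules := List.getElem_mem _
    refine ⟨_, .step G.rules[r.1] hmem (List.ofFn ξ) ?_, ?_⟩
    · rw [List.forall₂_iff_get]
      refine ⟨by simp [wGrammar], fun i h₁ h₂ => ?_⟩
      rw [List.get_ofFn]
      exact hξ ⟨i, h₁⟩
    · change compLength r.2 _ = _
      rw [compLength_map_evalItems (fun A => (hG.1 A).2) _ (hG.2.2 _ hmem) (hdup _ hmem)]
      refine congrArg₂ _ rfl (Finset.sum_congr rfl fun i _ => ?_)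
      rw [← hlen i, List.getD_eq_getElem _ _ (by simp [wGrammar])]
      simp [wGrammar]

/-- The set of lengths of an MCFL is bounded or contains an infinite arithmetic progression. -/
theorem exists_length_progression {G : PMCFG T} {m : ℕ} (hm : 1 ≤ m) (hG : G.WF m)
    (hdup : G.NonDup) (hunb : ∀ B, ∃ w ∈ G.lang, B < w.length) :
    ∃ a b, 0 < b ∧ ∀ k, ∃ w ∈ G.lang, w.length = a + k * b := by
  have hlen : ∀ w : List T, compLength {(⟨0, hm⟩ : Fin m)} [w] = w.length := by
    simp [compLength]
  obtain ⟨a, b, hb, hab⟩ := WGrammar.exists_progression (W := G.wGrammar m)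
    (G.start, {⟨0, hm⟩}) fun B => by
      obtain ⟨w, hw, hB⟩ := hunb B
      exact ⟨_, (hlen w).symm ▸ hB, Derives.yields hG hdup hw _⟩
  refine ⟨a, b, hb, fun k => ?_⟩
  obtain ⟨ξ, hξ, hx⟩ := exists_derives_of_yields hG hdup (hab k)
  obtain ⟨w, rfl⟩ := List.length_eq_one_iff.mp ((hξ.length_eq hG).trans hG.2.1)
  exact ⟨w, hξ, (hlen w).symm.trans hx⟩

end PMCFG

/-! ### A nonerasing stack automaton for the unary triangular numbers -/

/-- The stack is `true` (the bottom symbol) followed by copies of `false`. In state `true` the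
pointer climbs to the top, where a new `false` is pushed; in state `false` it descends, reading
one input symbol for each `false`. -/
def triSA : SA Unit where
  Q := Bool
  finQ := inferInstance
  Γ := Bool
  finΓ := inferInstance
  q0 := true
  Z0 := true
  F := {true}
  push q _ Z := {p | q = true ∧ p = (false, false, [Z, false])}
  read q _ Z top := {p | (q = false ∧ Z = false ∧ p = (false, true, .left)) ∨
    (q = false ∧ Z = true ∧ p = (true, false, .stay)) ∨
    (q = true ∧ top = false ∧ p = (true, false, .right))}

namespace triSA

/-- The configuration with state `q`, remaining input `u`, stack `l` up to the pointer and stack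
`r` above it. -/
def cfg (q : Bool) (u : List Unit) (l r : List Bool) : triSA.Conf := (q, u, l, r)

theorem cfg_inj {q q' : Bool} {u u' : List Unit} {l l' r r' : List Bool} :
    cfg q u l r = cfg q' u' l' r' ↔ q = q' ∧ u = u' ∧ l = l' ∧ r = r' := by
  constructor
  · intro h
    cases h
    exact ⟨rfl, rfl, rfl, rfl⟩
  · rintro ⟨rfl, rfl, rfl, rfl⟩
    rfl

theorem cfg_push (u : List Unit) (γ : List Bool) (Z : Bool) :
    triSA.Step (cfg true u (γ ++ [Z]) []) (cfg false u (γ ++ [Z, false]) []) :=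
  SA.Step.push (M := triSA) true u γ Z false false [Z, false] ⟨rfl, rfl⟩ nofun

theorem cfg_down (a : Unit) (u : List Unit) {γ : List Bool} (hγ : γ ≠ []) (r : List Bool) :
    triSA.Step (cfg false (a :: u) (γ ++ [false]) r) (cfg false u γ (false :: r)) :=
  SA.Step.read (M := triSA) false (a :: u) γ false r false true .left (.inl ⟨rfl, rfl, rfl⟩)
    (fun _ => List.cons_ne_nil _ _) (fun _ => hγ) nofun

theorem cfg_turn (u : List Unit) (γ r : List Bool) :
    triSA.Step (cfg false u (γ ++ [true]) r) (cfg true u (γ ++ [true]) r) :=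
  SA.Step.read (M := triSA) false u γ true r true false .stay (.inr (.inl ⟨rfl, rfl, rfl⟩))
    nofun nofun nofun

theorem cfg_up (u : List Unit) (γ : List Bool) (Z b : Bool) (r : List Bool) :
    triSA.Step (cfg true u (γ ++ [Z]) (b :: r)) (cfg true u (γ ++ [Z, b]) r) :=
  SA.Step.read (M := triSA) true u γ Z (b :: r) true false .right
    (.inr (.inr ⟨rfl, rfl, rfl⟩)) nofun nofun (fun _ => List.cons_ne_nil _ _)

theorem step_cases {c c' : triSA.Conf} (h : triSA.Step c c') :
    (∃ u γ Z, c = cfg true u (γ ++ [Z]) [] ∧ c' = cfg false u (γ ++ [Z, false]) []) ∨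
    (∃ a u γ r, c = cfg false (a :: u) (γ ++ [false]) r ∧ c' = cfg false u γ (false :: r)) ∨
    (∃ u γ r, c = cfg false u (γ ++ [true]) r ∧ c' = cfg true u (γ ++ [true]) r) ∨
    (∃ u γ Z b r, c = cfg true u (γ ++ [Z]) (b :: r) ∧ c' = cfg true u (γ ++ [Z, b]) r) := by
  cases h with
  | push q u γ Z q' d y hmem hd =>
    obtain ⟨rfl, hp⟩ := hmem
    cases hp
    exact .inl ⟨u, γ, Z, rfl, rfl⟩
  | read q u γ Z above q' d e hmem hd hleft hright =>
    rcases hmem with ⟨rfl, rfl, hp⟩ | ⟨rfl, rfl, hp⟩ | ⟨rfl, htop, hp⟩ <;> cases hp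
    · cases u with
      | nil => exact absurd rfl (hd rfl)
      | cons a u => exact .inr (.inl ⟨a, u, γ, above, rfl, rfl⟩)
    · exact .inr (.inr (.inl ⟨u, γ, above, rfl, rfl⟩))
    · cases above with
      | nil => exact absurd rfl (hright rfl)
      | cons b r => exact .inr (.inr (.inr ⟨u, γ, Z, b, r, rfl, rfl⟩))

/-- The configuration with `j` symbols `false` up to the pointer and `k` above it. -/
def conf (q : Bool) (u : List Unit) (j k : ℕ) : triSA.Conf :=
  cfg q u (true :: List.replicate j false) (List.replicate k false)

/-- The `n`-th triangular number. -/
def tri (n : ℕ) : ℕ := ∑ i ∈ Finset.range (n + 1), i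

theorem tri_succ (n : ℕ) : tri (n + 1) = tri n + (n + 1) := Finset.sum_range_succ _ _

theorem bottom_cons_replicate_succ (j : ℕ) :
    true :: List.replicate (j + 1) false = (true :: List.replicate j false) ++ [false] := by
  simp [List.replicate_succ']

theorem exists_eq_append_singleton (j : ℕ) :
    ∃ γ Z, true :: List.replicate j false = γ ++ [Z] ∧
      true :: List.replicate (j + 1) false = γ ++ [Z, false] := by
  cases j with
  | zero => exact ⟨[], true, rfl, rfl⟩
  | succ j =>
    refine ⟨_, _, bottom_cons_replicate_succ j, ?_⟩
    rw [bottom_cons_replicate_succ, bottom_cons_replicate_succ, List.append_assoc]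
    rfl

theorem step_push (u : List Unit) (j : ℕ) :
    triSA.Step (conf true u j 0) (conf false u (j + 1) 0) := by
  obtain ⟨γ, Z, h₁, h₂⟩ := exists_eq_append_singleton j
  unfold conf
  rw [h₁, h₂]
  exact cfg_push u γ Z

theorem step_down (u : List Unit) (j k : ℕ) :
    triSA.Step (conf false (() :: u) (j + 1) k) (conf false u j (k + 1)) := by
  unfold conf
  rw [bottom_cons_replicate_succ]
  exact cfg_down () u (List.cons_ne_nil _ _) _

theorem step_turn (u : List Unit) (k : ℕ) :
    triSA.Step (conf false u 0 k) (conf true u 0 k) :=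
  cfg_turn u [] _

theorem step_up (u : List Unit) (j k : ℕ) :
    triSA.Step (conf true u j (k + 1)) (conf true u (j + 1) k) := by
  obtain ⟨γ, Z, h₁, h₂⟩ := exists_eq_append_singleton j
  unfold conf
  rw [h₁, h₂]
  exact cfg_up u γ Z false _

open Relation in
theorem steps_down (N j k : ℕ) :
    ReflTransGen triSA.Step (conf false (List.replicate (N + j) ()) j k)
      (conf false (List.replicate N ()) 0 (j + k)) := by
  induction j generalizing k with
  | zero => simpa using ReflTransGen.refl
  | succ j ih =>
    have := ih (k + 1)
    rw [← add_assoc, add_right_comm] at this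
    exact .head (step_down _ j k) this

open Relation in
theorem steps_up (u : List Unit) (j k : ℕ) :
    ReflTransGen triSA.Step (conf true u j k) (conf true u (j + k) 0) := by
  induction k generalizing j with
  | zero => exact ReflTransGen.refl
  | succ k ih =>
    have := ih (j + 1)
    rw [add_right_comm, add_assoc] at this
    exact .head (step_up u j k) this

open Relation in
theorem steps_cycles (N n : ℕ) :
    ReflTransGen triSA.Step (conf true (List.replicate (N + tri n) ()) 0 0)
      (conf true (List.replicate N ()) n 0) := by
  induction n generalizing N with
  | zero => exact ReflTransGen.refl
  | succ n ih =>
    have h := ih (N + (n + 1))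
    rw [show N + (n + 1) + tri n = N + tri (n + 1) by rw [tri_succ]; ring] at h
    have hup := steps_up (List.replicate N ()) 0 (n + 1)
    rw [zero_add] at hup
    exact (((h.tail (step_push _ _)).trans (steps_down N (n + 1) 0)).tail (step_turn _ _)).trans hup

/-- The reachable configurations on an input of length `N`. -/
def Inv (N : ℕ) (c : triSA.Conf) : Prop :=
  (∃ u j k, c = conf true u j k ∧ N = u.length + tri (j + k)) ∨
    ∃ u j k p, c = conf false u j k ∧ j + k = p + 1 ∧ N = u.length + tri p + k

theorem append_singleton_eq {γ : List Bool} {Z : Bool} {j : ℕ}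
    (h : γ ++ [Z] = true :: List.replicate j false) :
    (j = 0 ∧ γ = [] ∧ Z = true) ∨
      ∃ i, j = i + 1 ∧ γ = true :: List.replicate i false ∧ Z = false := by
  cases j with
  | zero =>
    left
    simpa [List.append_eq_singleton_iff] using h
  | succ i =>
    right
    rw [bottom_cons_replicate_succ] at h
    obtain ⟨h₁, h₂⟩ := List.append_inj' h rfl
    exact ⟨i, rfl, h₁, by simpa using h₂⟩

theorem Inv.step {N : ℕ} {c c' : triSA.Conf} (hc : Inv N c) (h : triSA.Step c c') :
    Inv N c' := by
  have hsucc : ∀ {γ : List Bool} {Z : Bool} {j : ℕ}, γ ++ [Z] = true :: List.replicate j false →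
      γ ++ [Z, false] = true :: List.replicate (j + 1) false := by
    intro γ Z j hγ
    rw [bottom_cons_replicate_succ, ← hγ, List.append_assoc]
    rfl
  rcases step_cases h with ⟨u, γ, Z, rfl, rfl⟩ | ⟨a, u, γ, r, rfl, rfl⟩ | ⟨u, γ, r, rfl, rfl⟩ |
    ⟨u, γ, Z, b, r, rfl, rfl⟩ <;>
    rcases hc with ⟨u', j, k, hc, hN⟩ | ⟨u', j, k, p, hc, hp, hN⟩ <;>
    obtain ⟨hq, rfl, hγ, hk⟩ := cfg_inj.mp hc <;> try cases hq
  · obtain rfl : k = 0 := by simpa using hk.symm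
    exact .inr ⟨u, j + 1, 0, j, cfg_inj.mpr ⟨rfl, rfl, hsucc hγ, rfl⟩, rfl, hN⟩
  · rcases append_singleton_eq hγ with ⟨-, -, h⟩ | ⟨i, rfl, rfl, -⟩
    · cases h
    · refine .inr ⟨u, i, k + 1, p, cfg_inj.mpr ⟨rfl, rfl, rfl, hk ▸ rfl⟩, by omega, ?_⟩
      rw [hN, List.length_cons]
      ring
  · rcases append_singleton_eq hγ with ⟨rfl, rfl, -⟩ | ⟨i, -, -, h⟩
    · refine .inl ⟨u, 0, k, cfg_inj.mpr ⟨rfl, rfl, rfl, hk⟩, ?_⟩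
      rw [hp, tri_succ]
      omega
    · cases h
  · cases k with
    | zero => cases hk
    | succ k =>
      obtain ⟨rfl, rfl⟩ := List.cons.inj hk
      refine .inl ⟨u, j + 1, k, cfg_inj.mpr ⟨rfl, rfl, hsucc hγ, rfl⟩, ?_⟩
      rw [hN, add_right_comm j 1 k, add_assoc j k 1]

theorem mem_lang_iff (w : List Unit) : w ∈ triSA.lang ↔ ∃ n, w.length = tri n := by
  constructor
  · rintro ⟨qf, g1, g2, hq, h⟩
    have hinv : ∀ c, Relation.ReflTransGen triSA.Step (conf true w 0 0) c →
        Inv w.length c := by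
      intro c hc
      induction hc with
      | refl => exact .inl ⟨w, 0, 0, rfl, rfl⟩
      | tail _ hs ih => exact ih.step hs
    obtain rfl : qf = true := hq
    rcases hinv (cfg true [] g1 g2) h with ⟨u, j, k, hc, hN⟩ | ⟨u, j, k, p, hc, -⟩
    · obtain ⟨-, rfl, -, -⟩ := cfg_inj.mp hc
      exact ⟨j + k, by simpa using hN⟩
    · cases (cfg_inj.mp hc).1
  · rintro ⟨n, hn⟩
    have hw : w = List.replicate (0 + tri n) () := by
      rw [List.eq_replicate_iff]
      exact ⟨by omega, fun _ _ => rfl⟩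
    exact ⟨true, _, _, rfl, hw ▸ steps_cycles 0 n⟩

theorem le_tri (n : ℕ) : n ≤ tri n := by
  cases n with
  | zero => exact Nat.zero_le _
  | succ n => rw [tri_succ]; omega

theorem monotone_tri : Monotone tri := monotone_nat_of_le_succ fun n => by rw [tri_succ]; omega

theorem not_forall_progression (a b : ℕ) (hb : 0 < b) : ¬ ∀ k, ∃ n, tri n = a + k * b := by
  intro h
  obtain ⟨n, hn⟩ := h (tri b)
  obtain ⟨n', hn'⟩ := h (tri b + 1)
  have hbn : b ≤ n := by
    by_contra! hlt
    have h₁ := monotone_tri hlt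
    rw [Nat.succ_eq_add_one, tri_succ, hn] at h₁
    have h₂ := monotone_tri hlt.le
    nlinarith
  have hlt : n < n' := by
    by_contra! hle
    have := monotone_tri hle
    rw [hn, hn'] at this
    nlinarith
  have := monotone_tri hlt
  rw [Nat.succ_eq_add_one, tri_succ, hn, hn'] at this
  nlinarith

end triSA

/-- Corollary pmcfgsaandmcfgnesa (b). -/
theorem stmt19 :
    ∃ (T : Type) (M : SA T), M.NonErasing ∧
      ¬ ∃ (m : ℕ) (G : PMCFG T), 1 ≤ m ∧ G.WF m ∧ G.NonDup ∧ G.lang = M.lang := by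
  refine ⟨Unit, triSA, ?_, ?_⟩
  · rintro q a Z q' d y ⟨-, h⟩
    cases h
    exact List.cons_ne_nil _ _
  · rintro ⟨m, G, hm, hG, hdup, hlang⟩
    obtain ⟨a, b, hb, hab⟩ := PMCFG.exists_length_progression hm hG hdup fun B =>
      ⟨List.replicate (triSA.tri (B + 1)) (),
        hlang ▸ (triSA.mem_lang_iff _).mpr ⟨B + 1, by simp⟩, by
          simpa using triSA.le_tri (B + 1)⟩
    refine triSA.not_forall_progression a b hb fun k => ?_
    obtain ⟨w, hw, hk⟩ := hab k
    rw [hlang, triSA.mem_lang_iff] at hw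
    obtain ⟨n, hn⟩ := hw
    exact ⟨n, hn ▸ hk⟩

end Rewbs
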